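/- For every α > 0 and all a, t ∈ ℂ: A_{q²}^{(2α)}(a²; t²) = Σ_{j=0}^∞ ((a;q)_j q^{α j²} (−t)^j / (q;q)_j) · A_q^{(α)}(a; t q^{2αj}). Here A_{q²}^{(2α)}(a²; t²) = Σ_{n=0}^∞ (a²;q²)_n q^{4α n²} t^{2n}/(q²;q²)_n. -/

import Mathlib

open Complex

/-- The finite q-shifted factorial `(a;q)_n`. -/
noncomputable def qPoch (q a : ℂ) (n : ℕ) : ℂ := ∏ j ∈ Finset.range n, (1 - a * q ^ j)

/-- The generalized Ramanujan function `A_q^{(α)}(a;t) = Σ_{n≥0} (a;q)_n q^{αn²} t^n/(q;q)_n`. -/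
noncomputable def Aq (q α : ℝ) (a t : ℂ) : ℂ :=
  ∑' n : ℕ, qPoch (q : ℂ) a n * ((q ^ (α * (n : ℝ) ^ 2) : ℝ) : ℂ) * t ^ n / qPoch (q : ℂ) (q : ℂ) n

/-- The power series `Σ (a;q)_n / (q;q)_n X^n` of the `q`-binomial theorem. -/
noncomputable def qBinomialSeries (q a : ℂ) : PowerSeries ℂ :=
  PowerSeries.mk fun n => qPoch q a n / qPoch q q n

lemma qPoch_zero (q a : ℂ) : qPoch q a 0 = 1 := by simp [qPoch]

lemma qPoch_succ (q a : ℂ) (n : ℕ) : qPoch q a (n + 1) = qPoch q a n * (1 - a * q ^ n) :=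
  Finset.prod_range_succ _ _

lemma qPoch_self_ne_zero {q : ℂ} (hq : ∀ n : ℕ, q ^ (n + 1) ≠ 1) (n : ℕ) : qPoch q q n ≠ 0 := by
  refine Finset.prod_ne_zero_iff.2 fun j _ => sub_ne_zero.2 ?_
  rw [← pow_succ']
  exact (hq j).symm

lemma qPoch_div_succ {q : ℂ} (hq : ∀ n : ℕ, q ^ (n + 1) ≠ 1) (a : ℂ) (n : ℕ) :
    qPoch q a (n + 1) / qPoch q q (n + 1) * (1 - q ^ (n + 1)) =
      qPoch q a n / qPoch q q n * (1 - a * q ^ n) := by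
  have h1 := qPoch_self_ne_zero hq n
  have h2 : 1 - q ^ (n + 1) ≠ 0 := sub_ne_zero.2 (hq n).symm
  rw [qPoch_succ, qPoch_succ, ← pow_succ']
  field_simp

lemma constantCoeff_rescale (r : ℂ) (f : PowerSeries ℂ) :
    PowerSeries.constantCoeff (PowerSeries.rescale r f) = PowerSeries.constantCoeff f := by
  rw [← PowerSeries.coeff_zero_eq_constantCoeff_apply, PowerSeries.coeff_rescale, pow_zero, one_mul,
    PowerSeries.coeff_zero_eq_constantCoeff_apply]

/-- The functional equation `(1 - x) F(x) = (1 - a x) F(q x)` of the `q`-binomial series. -/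
lemma one_sub_X_mul_qBinomialSeries {q : ℂ} (hq : ∀ n : ℕ, q ^ (n + 1) ≠ 1) (a : ℂ) :
    (1 - PowerSeries.X) * qBinomialSeries q a =
      (1 - PowerSeries.C a * PowerSeries.X) * PowerSeries.rescale q (qBinomialSeries q a) := by
  ext n
  cases n with
  | zero => simp [sub_mul, mul_assoc, qBinomialSeries, constantCoeff_rescale]
  | succ n =>
    simp only [sub_mul, one_mul, mul_assoc, map_sub, PowerSeries.coeff_succ_X_mul,
      PowerSeries.coeff_C_mul, PowerSeries.coeff_rescale, qBinomialSeries, PowerSeries.coeff_mk]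
    linear_combination qPoch_div_succ hq a n

/-- The product `F(-x) F(x)` of `q`-binomial series satisfies
`(1 - x²) G(x) = (1 - a² x²) G(q x)`. -/
lemma one_sub_X_sq_mul_qBinomialSeries_mul {q : ℂ} (hq : ∀ n : ℕ, q ^ (n + 1) ≠ 1) (a : ℂ) :
    (1 - PowerSeries.X ^ 2) *
        (PowerSeries.rescale (-1) (qBinomialSeries q a) * qBinomialSeries q a) =
      (1 - PowerSeries.C (a ^ 2) * PowerSeries.X ^ 2) * PowerSeries.rescale q
        (PowerSeries.rescale (-1) (qBinomialSeries q a) * qBinomialSeries q a) := by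
  have h := one_sub_X_mul_qBinomialSeries hq a
  have h' := congrArg (PowerSeries.rescale (-1 : ℂ)) h
  have hC : PowerSeries.rescale (-1 : ℂ) (PowerSeries.C a) = PowerSeries.C a := by
    ext n
    rw [PowerSeries.coeff_rescale, PowerSeries.coeff_C]
    split_ifs with hn <;> simp [hn]
  have hX : PowerSeries.rescale (-1 : ℂ) PowerSeries.X = -PowerSeries.X := by
    simp [PowerSeries.rescale_X]
  simp only [map_mul, map_sub, map_one, hC, hX, PowerSeries.rescale_rescale] at h'
  simp only [map_mul, map_pow, PowerSeries.rescale_rescale]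
  rw [mul_comm q] at h'
  linear_combination
    (1 + PowerSeries.X) * PowerSeries.rescale (-1) (qBinomialSeries q a) * h +
    (1 - PowerSeries.C a * PowerSeries.X) * PowerSeries.rescale q (qBinomialSeries q a) * h'

lemma coeff_qBinomialSeries_mul_add_two {q : ℂ} (hq : ∀ n : ℕ, q ^ (n + 1) ≠ 1) (a : ℂ) (n : ℕ) :
    PowerSeries.coeff (n + 2)
        (PowerSeries.rescale (-1) (qBinomialSeries q a) * qBinomialSeries q a) *
        (1 - q ^ (n + 2)) =
      PowerSeries.coeff n
        (PowerSeries.rescale (-1) (qBinomialSeries q a) * qBinomialSeries q a) *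
        (1 - a ^ 2 * q ^ n) := by
  have h := congrArg (PowerSeries.coeff (n + 2)) (one_sub_X_sq_mul_qBinomialSeries_mul hq a)
  generalize PowerSeries.rescale (-1) (qBinomialSeries q a) * qBinomialSeries q a = G at *
  simp only [sub_mul, one_mul, mul_assoc, map_sub, PowerSeries.coeff_X_pow_mul,
    PowerSeries.coeff_C_mul, PowerSeries.coeff_rescale] at h
  linear_combination h

lemma coeff_odd_qBinomialSeries_mul {q : ℂ} (hq : ∀ n : ℕ, q ^ (n + 1) ≠ 1) (a : ℂ) (n : ℕ) :
    PowerSeries.coeff (2 * n + 1)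
      (PowerSeries.rescale (-1) (qBinomialSeries q a) * qBinomialSeries q a) = 0 := by
  induction n with
  | zero =>
    simp [PowerSeries.coeff_mul, Finset.Nat.antidiagonal_succ, PowerSeries.coeff_rescale,
      mul_comm]
  | succ n ih =>
    have h := coeff_qBinomialSeries_mul_add_two hq a (2 * n + 1)
    rw [ih, zero_mul] at h
    exact (mul_eq_zero.1 h).resolve_right (sub_ne_zero.2 (hq _).symm)

lemma coeff_even_qBinomialSeries_mul {q : ℂ} (hq : ∀ n : ℕ, q ^ (n + 1) ≠ 1) (a : ℂ) (n : ℕ) :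
    PowerSeries.coeff (2 * n)
        (PowerSeries.rescale (-1) (qBinomialSeries q a) * qBinomialSeries q a) =
      qPoch (q ^ 2) (a ^ 2) n / qPoch (q ^ 2) (q ^ 2) n := by
  have hq2 : ∀ n : ℕ, (q ^ 2) ^ (n + 1) ≠ 1 := fun n => by
    rw [← pow_mul]
    exact hq (2 * n + 1)
  induction n with
  | zero => simp [qBinomialSeries, qPoch_zero, constantCoeff_rescale]
  | succ n ih =>
    have h := coeff_qBinomialSeries_mul_add_two hq a (2 * n)
    have h' := qPoch_div_succ hq2 (a ^ 2) n
    rw [ih] at h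
    refine mul_right_cancel₀ (sub_ne_zero.2 (hq2 n).symm) (Eq.trans ?_ h'.symm)
    rw [← pow_mul, ← pow_mul]
    exact h

/-- The convolution `Σ_{j+m=N} (-1)^j c_j c_m`, with `c_n = (a;q)_n/(q;q)_n`, as a coefficient. -/
lemma coeff_qBinomialSeries_mul (q a : ℂ) (N : ℕ) :
    PowerSeries.coeff N
        (PowerSeries.rescale (-1) (qBinomialSeries q a) * qBinomialSeries q a) =
      ∑ p ∈ Finset.HasAntidiagonal.antidiagonal N, (-1) ^ p.1 * (qPoch q a p.1 / qPoch q q p.1) *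
        (qPoch q a p.2 / qPoch q q p.2) := by
  simp [PowerSeries.coeff_mul, PowerSeries.coeff_rescale, qBinomialSeries]

lemma ofReal_pow_succ_ne_one {q : ℝ} (hq0 : 0 < q) (hq1 : q < 1) (n : ℕ) :
    (q : ℂ) ^ (n + 1) ≠ 1 := by
  have := pow_lt_one₀ hq0.le hq1 n.succ_ne_zero
  exact_mod_cast this.ne

/-- The terms of the series defining `Aq` are absolutely summable. -/
lemma summable_norm_Aq_term {q : ℝ} (hq0 : 0 < q) (hq1 : q < 1) {α : ℝ} (hα : 0 < α) (a t : ℂ) :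
    Summable fun n : ℕ => ‖qPoch (q : ℂ) a n / qPoch (q : ℂ) (q : ℂ) n *
      ((q ^ (α * (n : ℝ) ^ 2) : ℝ) : ℂ) * t ^ n‖ := by
  have hq := ofReal_pow_succ_ne_one hq0 hq1
  have hpow : Filter.Tendsto (fun n : ℕ => (q : ℂ) ^ n) Filter.atTop (nhds 0) :=
    tendsto_pow_atTop_nhds_zero_of_norm_lt_one (by
      rwa [Complex.norm_real, Real.norm_of_nonneg hq0.le])
  have hr : Filter.Tendsto (fun n : ℕ => ((q ^ (2 * α) : ℝ) : ℂ) ^ n) Filter.atTop (nhds 0) :=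
    tendsto_pow_atTop_nhds_zero_of_norm_lt_one (by
      rw [Complex.norm_real, Real.norm_of_nonneg (by positivity)]
      exact Real.rpow_lt_one hq0.le hq1 (by positivity))
  have hlim : Filter.Tendsto (fun n : ℕ => (1 - a * (q : ℂ) ^ n) / (1 - (q : ℂ) ^ (n + 1)) *
      (((q ^ (2 * α) : ℝ) : ℂ) ^ n * ((q ^ α : ℝ) : ℂ)) * t) Filter.atTop (nhds 0) := by
    have h1 := (hpow.const_mul a).const_sub 1
    have h2 := ((Filter.tendsto_add_atTop_iff_nat 1).2 hpow).const_sub 1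
    simpa using ((h1.div h2 (by simp)).mul (hr.mul_const ((q ^ α : ℝ) : ℂ))).mul_const t
  have hev : ∀ᶠ n : ℕ in Filter.atTop, ‖(1 - a * (q : ℂ) ^ n) / (1 - (q : ℂ) ^ (n + 1)) *
      (((q ^ (2 * α) : ℝ) : ℂ) ^ n * ((q ^ α : ℝ) : ℂ)) * t‖ ≤ 1 / 2 := by
    have h := hlim.norm
    rw [norm_zero] at h
    exact h.eventually_le_const (by norm_num)
  refine summable_of_ratio_norm_eventually_le (r := 1 / 2) (by norm_num) ?_
  filter_upwards [hev] with n hn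
  rw [norm_norm, norm_norm]
  refine le_trans (le_of_eq ?_) (mul_le_mul_of_nonneg_right hn (norm_nonneg _))
  rw [← norm_mul]
  congr 1
  have hexp : q ^ (α * ((n + 1 : ℕ) : ℝ) ^ 2) =
      q ^ (α * (n : ℝ) ^ 2) * ((q ^ (2 * α)) ^ n * q ^ α) := by
    rw [← Real.rpow_natCast (q ^ (2 * α)), ← Real.rpow_mul hq0.le, ← Real.rpow_add hq0,
      ← Real.rpow_add hq0]
    congr 1
    push_cast
    ring
  have hne : 1 - (q : ℂ) ^ (n + 1) ≠ 0 := sub_ne_zero.2 (hq n).symm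
  rw [hexp, eq_div_of_mul_eq hne (qPoch_div_succ hq a n)]
  push_cast
  ring

/-- `A_{q²}^{(2α)}(a²;t²) = Σ_{j≥0} ((a;q)_j q^{αj²} (−t)^j/(q;q)_j) A_q^{(α)}(a;tq^{2αj})`,
where `A_{q²}^{(2α)}(a²;t²) = Σ_{n≥0} (a²;q²)_n q^{4αn²} t^{2n}/(q²;q²)_n`. -/
theorem Aq_quadratic_expansion (q : ℝ) (hq0 : 0 < q) (hq1 : q < 1) (α : ℝ) (hα : 0 < α)
    (a t : ℂ) :
    ∑' n : ℕ, qPoch ((q : ℂ) ^ 2) (a ^ 2) n * ((q ^ (4 * α * (n : ℝ) ^ 2) : ℝ) : ℂ) *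
        t ^ (2 * n) / qPoch ((q : ℂ) ^ 2) ((q : ℂ) ^ 2) n
    = ∑' j : ℕ,
        (qPoch (q : ℂ) a j * ((q ^ (α * (j : ℝ) ^ 2) : ℝ) : ℂ) * (-t) ^ j /
          qPoch (q : ℂ) (q : ℂ) j) *
          Aq q α a (t * ((q ^ (2 * α * (j : ℝ)) : ℝ) : ℂ)) := by
  have hq := ofReal_pow_succ_ne_one hq0 hq1
  set c : ℕ → ℂ := fun n => qPoch (q : ℂ) a n / qPoch (q : ℂ) (q : ℂ) n with hc
  set F : ℕ × ℕ → ℂ := fun p => ((-1) ^ p.1 * c p.1 * c p.2) *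
    (((q ^ (α * ((p.1 + p.2 : ℕ) : ℝ) ^ 2) : ℝ) : ℂ) * t ^ (p.1 + p.2)) with hF
  have hexp (j m : ℕ) : q ^ (α * ((j + m : ℕ) : ℝ) ^ 2) =
      q ^ (α * (j : ℝ) ^ 2) * q ^ (α * (m : ℝ) ^ 2) * (q ^ (2 * α * (j : ℝ))) ^ m := by
    rw [← Real.rpow_natCast (q ^ (2 * α * (j : ℝ))), ← Real.rpow_mul hq0.le, ← Real.rpow_add hq0,
      ← Real.rpow_add hq0]
    congr 1
    push_cast
    ring
  have hsum : Summable F := by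
    have hu := summable_norm_Aq_term hq0 hq1 hα a t
    refine Summable.of_norm_bounded
      (hu.mul_of_nonneg hu (fun _ => norm_nonneg _) fun _ => norm_nonneg _) fun p => ?_
    have hle : ‖(((q ^ (2 * α * (p.1 : ℝ))) ^ p.2 : ℝ) : ℂ)‖ ≤ 1 := by
      rw [Complex.norm_real, Real.norm_of_nonneg (by positivity)]
      exact pow_le_one₀ (by positivity) (Real.rpow_le_one hq0.le hq1.le (by positivity))
    rw [← norm_mul]
    refine le_trans (le_of_eq ?_) (mul_le_of_le_one_right (norm_nonneg _) hle)
    have hsign : ‖F p‖ = ‖(-1) ^ p.1 * F p‖ := by simp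
    rw [hsign, ← norm_mul]
    congr 1
    simp only [hF, hexp]
    have hs : ((-1 : ℂ) ^ p.1) * (-1) ^ p.1 = 1 := by rw [← mul_pow]; simp
    push_cast
    rw [pow_add]
    linear_combination (c p.1 * c p.2 * (((q ^ (α * (p.1 : ℝ) ^ 2) : ℝ) : ℂ) *
      ((q ^ (α * (p.2 : ℝ) ^ 2) : ℝ) : ℂ) * ((q ^ (2 * α * (p.1 : ℝ)) : ℝ) : ℂ) ^ p.2) *
      (t ^ p.1 * t ^ p.2)) * hs
  have hR : ∑' p, F p = ∑' j : ℕ,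
      (qPoch (q : ℂ) a j * ((q ^ (α * (j : ℝ) ^ 2) : ℝ) : ℂ) * (-t) ^ j /
        qPoch (q : ℂ) (q : ℂ) j) * Aq q α a (t * ((q ^ (2 * α * (j : ℝ)) : ℝ) : ℂ)) := by
    rw [hsum.tsum_prod]
    refine tsum_congr fun j => ?_
    rw [Aq, ← tsum_mul_left]
    refine tsum_congr fun m => ?_
    simp only [hF, hc, hexp]
    push_cast
    rw [neg_pow t, mul_pow, pow_add]
    ring
  have hL : ∑' p, F p = ∑' N : ℕ, PowerSeries.coeff N
      (PowerSeries.rescale (-1) (qBinomialSeries q a) * qBinomialSeries q a) *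
      (((q ^ (α * (N : ℝ) ^ 2) : ℝ) : ℂ) * t ^ N) := by
    rw [← Finset.HasAntidiagonal.sigmaAntidiagonalEquivProd.tsum_eq F]
    refine (Finset.HasAntidiagonal.sigmaAntidiagonalEquivProd.summable_iff.2 hsum).tsum_sigma.trans
      ?_
    refine tsum_congr fun N => ?_
    rw [coeff_qBinomialSeries_mul, Finset.sum_mul, tsum_fintype,
      ← Finset.sum_coe_sort (Finset.HasAntidiagonal.antidiagonal N)]
    refine Finset.sum_congr rfl fun p _ => ?_
    simp only [Function.comp_apply, hF, hc,
      Finset.HasAntidiagonal.sigmaAntidiagonalEquivProd_apply,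
      Finset.HasAntidiagonal.mem_antidiagonal.1 p.2]
  rw [← hR, hL]
  refine Eq.trans ?_ ((mul_right_injective₀ (two_ne_zero' ℕ)).tsum_eq ?_)
  · refine tsum_congr fun n => ?_
    simp only [coeff_even_qBinomialSeries_mul hq]
    have h4 : 4 * α * (n : ℝ) ^ 2 = α * ((2 * n : ℕ) : ℝ) ^ 2 := by
      push_cast
      ring
    rw [h4]
    ring
  · intro N hN
    obtain ⟨n, rfl | rfl⟩ := N.even_or_odd'
    · exact ⟨n, rfl⟩
    · exact absurd (by simp only [coeff_odd_qBinomialSeries_mul hq, zero_mul]) hN
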